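/- Let p ∈ [1,∞) and ε > 0. The operator L_ε : C_c²(ℝⁿ) → L^p(ℝⁿ), L_ε u(x) = ∫_{ℝⁿ} J_ε(x−y)(u(x) − u(y) − ∇u(x)·(x−y)) dy, extends uniquely to a bounded linear operator L_ε : W^{2,p}(ℝⁿ) → L^p(ℝⁿ) satisfying ‖L_ε u‖_{L^p(ℝⁿ)} ≤ C_* ‖u‖_{W^{2,p}(ℝⁿ)} for all u ∈ W^{2,p}(ℝⁿ), where the constant C_* > 0 depends only on ρ and p (in particular it is independent of ε). -/

import Mathlib

open MeasureTheory Filter Topology ENNReal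

noncomputable section

abbrev EV (n : ℕ) := EuclideanSpace ℝ (Fin n)

/-- The kernel `J(x) = ρ(x)/|x|²`. -/
def kernelJ {n : ℕ} (ρ : EV n → ℝ) (x : EV n) : ℝ := ρ x / ‖x‖ ^ 2

/-- The rescaled density `ρ_ε(x) = ε^{-n} ρ(x/ε)`. -/
def scaled {n : ℕ} (ρ : EV n → ℝ) (ε : ℝ) (x : EV n) : ℝ := (ε ^ n)⁻¹ * ρ (ε⁻¹ • x)

/-- Assumption (A1): `ρ` is measurable, nonnegative, not a.e. zero, even,
and `∫ ρ(x)(1+|x|) dx < ∞`. -/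
def A1 {n : ℕ} (ρ : EV n → ℝ) : Prop :=
  Measurable ρ ∧ (∀ x, 0 ≤ ρ x) ∧ ¬ (ρ =ᵐ[volume] (fun _ => (0 : ℝ))) ∧
  (∀ᵐ x : EV n ∂volume, ρ (-x) = ρ x) ∧
  Integrable (fun x : EV n => ρ x * (1 + ‖x‖)) volume

/-- `L_ε u (x) = ∫_{ℝⁿ} J_ε(x-y) (u(x) - u(y) - ∇u(x)·(x-y)) dy`. -/
def nlOp {n : ℕ} (ρ : EV n → ℝ) (ε : ℝ) (u : EV n → ℝ) (x : EV n) : ℝ :=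
  ∫ y : EV n, kernelJ (scaled ρ ε) (x - y) * (u x - u y - fderiv ℝ u x (x - y))

/-- The classical partial derivative `∂ᵢ u`. -/
def partialD {n : ℕ} (i : Fin n) (u : EV n → ℝ) : EV n → ℝ :=
  fun x => fderiv ℝ u x (EuclideanSpace.single i 1)

/-- Iterated classical partial derivatives along a list of directions. -/
def partialDList {n : ℕ} : List (Fin n) → (EV n → ℝ) → (EV n → ℝ)
  | [], u => u
  | i :: l, u => partialD i (partialDList l u)

/-- The momentum matrix `M = (1/2)∫_{ℝⁿ} J(z) z ⊗ z dz`. -/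
def momentum {n : ℕ} (ρ : EV n → ℝ) : Matrix (Fin n) (Fin n) ℝ :=
  Matrix.of fun i j => (1 / 2 : ℝ) * ∫ z : EV n, kernelJ ρ z * z i * z j

/-- `v = ∂ᵢ u` weakly on `Ω`. -/
def WeakDerivOn {n : ℕ} (Ω : Set (EV n)) (i : Fin n) (u v : EV n → ℝ) : Prop :=
  ∀ φ : EV n → ℝ, ContDiff ℝ (⊤ : ℕ∞) φ → HasCompactSupport φ → tsupport φ ⊆ Ω →
    ∫ x in Ω, u x * partialD i φ x = - ∫ x in Ω, v x * φ x

/-- `D` is a system of weak partial derivatives of `u` on `Ω` up to order `k`,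
all lying in `L^p(Ω)`; i.e. `D` witnesses that `u ∈ W^{k,p}(Ω)`. -/
def IsSobDerivs {n : ℕ} (Ω : Set (EV n)) (k : ℕ) (p : ℝ≥0∞) (u : EV n → ℝ)
    (D : List (Fin n) → EV n → ℝ) : Prop :=
  D [] = u ∧
  (∀ l : List (Fin n), l.length < k → ∀ i : Fin n, WeakDerivOn Ω i (D l) (D (i :: l))) ∧
  (∀ l : List (Fin n), l.length ≤ k → MemLp (D l) p (volume.restrict Ω))

/-- `u ∈ W^{k,p}(Ω)`. -/
def MemW {n : ℕ} (Ω : Set (EV n)) (k : ℕ) (p : ℝ≥0∞) (u : EV n → ℝ) : Prop :=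
  ∃ D, IsSobDerivs Ω k p u D

/-- The `W^{k,p}`-norm computed from a system `D` of weak derivatives:
the sum of the `L^p` norms of all weak derivatives of order at most `k`. -/
def WNormD {n : ℕ} (k : ℕ) (p : ℝ≥0∞) (μ : Measure (EV n))
    (D : List (Fin n) → EV n → ℝ) : ℝ≥0∞ :=
  ∑' l : List (Fin n), if l.length ≤ k then eLpNorm (D l) p μ else 0

/-- `L` is a bounded linear extension to `W^{2,p}(ℝⁿ)`, with operator bound `C`,
of the nonlocal operator `L_ε` (defined by the principal-value formula on `C_c²(ℝⁿ)`). -/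
def IsNLExt {n : ℕ} (ρ : EV n → ℝ) (p : ℝ≥0∞) (ε C : ℝ)
    (L : (EV n → ℝ) → EV n → ℝ) : Prop :=
  (∀ u : EV n → ℝ, ContDiff ℝ 2 u → HasCompactSupport u → L u =ᵐ[volume] nlOp ρ ε u) ∧
  (∀ u v : EV n → ℝ, MemW Set.univ 2 p u → MemW Set.univ 2 p v → ∀ a b : ℝ,
    L (fun x => a * u x + b * v x) =ᵐ[volume] fun x => a * L u x + b * L v x) ∧
  (∀ u : EV n → ℝ, MemW Set.univ 2 p u → MemLp (L u) p volume) ∧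
  (∀ u D, IsSobDerivs Set.univ 2 p u D →
    eLpNorm (L u) p volume ≤ ENNReal.ofReal C * WNormD 2 p volume D)

theorem aux_jensen {n : ℕ} {W : Type*} [MeasurableSpace W] (μ : Measure W) [IsFiniteMeasure μ]
    (T : W → EV n) (hT : Measurable T) (h : EV n → ℝ≥0∞) (hh : Measurable h)
    (p : ℝ≥0∞) (hp1 : 1 ≤ p) (hp : p ≠ ⊤) :
    eLpNorm (fun x => ∫⁻ w, h (x - T w) ∂μ) p volume ≤ μ Set.univ * eLpNorm h p volume := by
  have hp0 : p ≠ 0 := (zero_lt_one.trans_le hp1).ne'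
  have hq : 1 ≤ p.toReal := by
    rw [← ENNReal.toReal_one]; exact ENNReal.toReal_mono hp hp1
  rw [eLpNorm_eq_lintegral_rpow_enorm_toReal hp0 hp, eLpNorm_eq_lintegral_rpow_enorm_toReal hp0 hp]
  simp only [enorm_eq_self]
  set q := p.toReal with hqdef
  have hq0 : 0 < q := by linarith
  have hmeas : Measurable (Function.uncurry fun (x : EV n) (w : W) => h (x - T w) ^ q) := by
    apply Measurable.pow_const
    exact hh.comp (measurable_fst.sub (hT.comp measurable_snd))
  have key : ∫⁻ x, (∫⁻ w, h (x - T w) ∂μ) ^ q ≤ μ Set.univ ^ q * ∫⁻ x, h x ^ q := by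
    calc ∫⁻ x, (∫⁻ w, h (x - T w) ∂μ) ^ q
        ≤ ∫⁻ x, μ Set.univ ^ (q - 1) * ∫⁻ w, h (x - T w) ^ q ∂μ := by
          apply lintegral_mono
          intro x
          have hm : Measurable fun w => h (x - T w) := hh.comp (measurable_const.sub hT)
          have := eLpNorm'_le_eLpNorm'_mul_rpow_measure_univ (μ := μ) zero_lt_one hq
            hm.aestronglyMeasurable
          simp only [eLpNorm', enorm_eq_self, ENNReal.rpow_one, div_one] at this
          calc _ ≤ ((∫⁻ w, h (x - T w) ^ q ∂μ) ^ (1 / q) * μ Set.univ ^ (1 - 1 / q)) ^ q :=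
                ENNReal.rpow_le_rpow this hq0.le
            _ = _ := by
                rw [ENNReal.mul_rpow_of_nonneg _ _ hq0.le, ← ENNReal.rpow_mul, ← ENNReal.rpow_mul,
                  one_div_mul_cancel hq0.ne', ENNReal.rpow_one, mul_comm]
                congr 2
                field_simp
      _ = μ Set.univ ^ (q - 1) * ∫⁻ x, ∫⁻ w, h (x - T w) ^ q ∂μ := by
          rw [lintegral_const_mul' _ _ (ENNReal.rpow_ne_top_of_nonneg (by linarith) (measure_ne_top _ _))]
      _ = μ Set.univ ^ (q - 1) * ∫⁻ w, (∫⁻ x : EV n, h (x - T w) ^ q) ∂μ := by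
          rw [lintegral_lintegral_swap hmeas.aemeasurable]
      _ = μ Set.univ ^ (q - 1) * ((∫⁻ x, h x ^ q) * μ Set.univ) := by
          congr 1
          rw [← lintegral_const]
          apply lintegral_congr
          intro w
          exact lintegral_sub_right_eq_self (fun x => h x ^ q) (T w)
      _ = _ := by
          rw [mul_comm (∫⁻ x, h x ^ q), ← mul_assoc]
          congr 1
          by_cases h0 : μ Set.univ = 0
          · simp [h0, hq0]
          · conv_lhs => rw [← ENNReal.rpow_one (μ Set.univ), ← ENNReal.rpow_mul]
            rw [← ENNReal.rpow_add _ _ h0 (measure_ne_top _ _)]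
            congr 1; ring
  calc _ ≤ (μ Set.univ ^ q * ∫⁻ x, h x ^ q) ^ (1 / q) := by gcongr
    _ = _ := by
      rw [ENNReal.mul_rpow_of_nonneg _ _ (by positivity), ← ENNReal.rpow_mul,
        mul_one_div_cancel hq0.ne', ENNReal.rpow_one]

theorem partialD_partialD {n : ℕ} {u : EV n → ℝ} (hu : ContDiff ℝ 2 u) (i j : Fin n) (x : EV n) :
    partialDList [i, j] u x = fderiv ℝ (fderiv ℝ u) x (EuclideanSpace.single i 1)
      (EuclideanSpace.single j 1) := by
  have hd : DifferentiableAt ℝ (fderiv ℝ u) x :=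
    ((hu.fderiv_right (m := 1) (by norm_num)).differentiable one_ne_zero) x
  have : partialDList [i, j] u x = fderiv ℝ (fun y => fderiv ℝ u y (EuclideanSpace.single j 1)) x
    (EuclideanSpace.single i 1) := rfl
  rw [this, fderiv_clm_apply hd (differentiableAt_const _)]
  simp

/-- sum of absolute values of the second derivatives -/
def hessSum {n : ℕ} (u : EV n → ℝ) (x : EV n) : ℝ :=
  ∑ i : Fin n, ∑ j : Fin n, ‖partialDList [i, j] u x‖

theorem hessSum_nonneg {n : ℕ} (u : EV n → ℝ) (x : EV n) : 0 ≤ hessSum u x := by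
  unfold hessSum; positivity

theorem hess_bound {n : ℕ} {u : EV n → ℝ} (hu : ContDiff ℝ 2 u) (x z : EV n) :
    ‖fderiv ℝ (fderiv ℝ u) x z z‖ ≤ ‖z‖ ^ 2 * hessSum u x := by
  have hz : z = ∑ i, z i • (EuclideanSpace.single i (1:ℝ)) := by
    ext k
    simp [Finset.sum_apply, Pi.single_apply]
  have hzi : ∀ i, ‖z i‖ ≤ ‖z‖ := fun i => PiLp.norm_apply_le z i
  set B := fderiv ℝ (fderiv ℝ u) x
  have : B z z = ∑ i, ∑ j, z i * (z j * partialDList [i, j] u x) := by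
    conv_lhs => rw [hz]
    simp only [map_sum, map_smul, _root_.sum_apply, _root_.smul_apply,
      smul_eq_mul, partialD_partialD hu]
    simp only [Finset.mul_sum]
    rw [Finset.sum_comm]
    refine Finset.sum_congr rfl fun i _ => Finset.sum_congr rfl fun j _ => ?_
    ring
  rw [this, hessSum, Finset.mul_sum]
  refine (norm_sum_le _ _).trans (Finset.sum_le_sum fun i _ => ?_)
  rw [Finset.mul_sum]
  refine (norm_sum_le _ _).trans (Finset.sum_le_sum fun j _ => ?_)
  rw [norm_mul, norm_mul, ← mul_assoc, sq]
  gcongr <;> apply hzi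

theorem partialD_contDiff {n : ℕ} {u : EV n → ℝ} {k m : ℕ∞} (hu : ContDiff ℝ m u) (h : k + 1 ≤ m)
    (i : Fin n) : ContDiff ℝ k (partialD i u) :=
  (hu.fderiv_right (m := k) (by exact_mod_cast h)).clm_apply contDiff_const

theorem partialD_compact {n : ℕ} {u : EV n → ℝ} (hu : HasCompactSupport u) (i : Fin n) :
    HasCompactSupport (partialD i u) := by
  have := (hu.fderiv (𝕜 := ℝ))
  exact this.comp_left (g := fun (A : EV n →L[ℝ] ℝ) => A (EuclideanSpace.single i 1)) (by simp)

theorem partialDList_compact {n : ℕ} {u : EV n → ℝ} (hu : HasCompactSupport u) (l : List (Fin n)) :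
    HasCompactSupport (partialDList l u) := by
  induction l with
  | nil => exact hu
  | cons i l ih => exact partialD_compact ih i

theorem partialDList_contDiff {n : ℕ} {u : EV n → ℝ} (hu : ContDiff ℝ 2 u) (l : List (Fin n))
    (hl : l.length ≤ 2) : ContDiff ℝ ((2 - l.length : ℕ) : ℕ∞) (partialDList l u) := by
  induction l with
  | nil => exact_mod_cast hu
  | cons i l ih =>
    simp only [List.length_cons] at hl ⊢
    refine partialD_contDiff (ih (by omega)) ?_ i
    norm_cast
    omega

theorem partialDList_cont {n : ℕ} {u : EV n → ℝ} (hu : ContDiff ℝ 2 u) (l : List (Fin n))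
    (hl : l.length ≤ 2) : Continuous (partialDList l u) :=
  (partialDList_contDiff hu l hl).continuous

theorem hessSum_cont {n : ℕ} {u : EV n → ℝ} (hu : ContDiff ℝ 2 u) : Continuous (hessSum u) := by
  unfold hessSum
  refine continuous_finsetSum _ fun i _ => continuous_finsetSum _ fun j _ => ?_
  exact (partialDList_cont hu [i, j] (by simp)).norm

theorem hessSum_bdd {n : ℕ} {u : EV n → ℝ} (hu : ContDiff ℝ 2 u) (hc : HasCompactSupport u) :
    ∃ B : ℝ, ∀ x, hessSum u x ≤ B := by
  have h : ∀ i j : Fin n, ∃ B : ℝ, ∀ x, ‖partialDList [i, j] u x‖ ≤ B := fun i j =>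
    (partialDList_compact hc [i, j]).exists_bound_of_continuous
      (partialDList_cont hu [i, j] (by simp))
  choose B hB using h
  exact ⟨∑ i, ∑ j, B i j, fun x => Finset.sum_le_sum fun i _ => Finset.sum_le_sum fun j _ => hB i j x⟩

theorem taylor_bound {n : ℕ} {u : EV n → ℝ} (hu : ContDiff ℝ 2 u) (x z : EV n) :
    ‖u x - u (x - z) - fderiv ℝ u x z‖ ≤ ‖z‖ ^ 2 * ∫ t in (0:ℝ)..1, hessSum u (x - t • z) := by
  have hu1 : ContDiff ℝ 1 (fderiv ℝ u) := hu.fderiv_right (by norm_num)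
  have hline : ∀ t : ℝ, HasDerivAt (fun t : ℝ => x - t • z) (-z) t := fun t => by
    simpa using ((hasDerivAt_id t).smul_const z).const_sub x
  have h1 : ∀ t : ℝ, HasDerivAt (fun t : ℝ => u (x - t • z)) (fderiv ℝ u (x - t • z) (-z)) t :=
    fun t => ((hu.differentiable two_ne_zero) _).hasFDerivAt.comp_hasDerivAt t (hline t)
  have h2 : ∀ t : ℝ, HasDerivAt (fun t : ℝ => fderiv ℝ u (x - t • z))
      (fderiv ℝ (fderiv ℝ u) (x - t • z) (-z)) t :=
    fun t => ((hu1.differentiable one_ne_zero) _).hasFDerivAt.comp_hasDerivAt t (hline t)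
  have h3 : ∀ t : ℝ, HasDerivAt (fun t : ℝ => u (x - t • z) - (1 - t) * fderiv ℝ u (x - t • z) z)
      ((1 - t) * fderiv ℝ (fderiv ℝ u) (x - t • z) z z) t := fun t => by
    have a := (h2 t).clm_apply (hasDerivAt_const t z)
    have b := (((hasDerivAt_id t).const_sub 1).mul a)
    refine ((h1 t).sub b).congr_deriv ?_
    simp
  have hcl : Continuous fun t : ℝ => x - t • z := by fun_prop
  have hc : Continuous fun t : ℝ => (1 - t) * fderiv ℝ (fderiv ℝ u) (x - t • z) z z := by
    have : Continuous fun t : ℝ => fderiv ℝ (fderiv ℝ u) (x - t • z) :=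
      (hu1.continuous_fderiv one_ne_zero).comp hcl
    fun_prop
  have := intervalIntegral.integral_eq_sub_of_hasDerivAt (a := 0) (b := 1) (fun t _ => h3 t)
    (hc.intervalIntegrable _ _)
  have e : u x - u (x - z) - fderiv ℝ u x z =
      - ∫ t in (0:ℝ)..1, (1 - t) * fderiv ℝ (fderiv ℝ u) (x - t • z) z z := by
    rw [this]; simp; ring
  rw [e, norm_neg, ← intervalIntegral.integral_const_mul]
  refine intervalIntegral.norm_integral_le_of_norm_le zero_le_one ?_ ?_
  · refine Eventually.of_forall fun t ht => ?_
    rw [norm_mul]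
    calc _ ≤ 1 * ‖fderiv ℝ (fderiv ℝ u) (x - t • z) z z‖ := by
          gcongr
          rw [Real.norm_eq_abs, abs_le]; constructor <;> linarith [ht.1, ht.2]
      _ ≤ _ := by rw [one_mul]; exact hess_bound hu _ _
  · exact (((hessSum_cont hu).comp hcl).const_mul _ |>.intervalIntegrable _ _)

theorem scaled_meas {n : ℕ} {ρ : EV n → ℝ} (hρ : A1 ρ) (ε : ℝ) : Measurable (scaled ρ ε) := by
  unfold scaled
  exact (hρ.1.comp (measurable_const_smul _)).const_mul _

theorem scaled_nonneg {n : ℕ} {ρ : EV n → ℝ} (hρ : A1 ρ) {ε : ℝ} (hε : 0 < ε) (x : EV n) :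
    0 ≤ scaled ρ ε x := mul_nonneg (by positivity) (hρ.2.1 _)

theorem rho_integrable {n : ℕ} {ρ : EV n → ℝ} (hρ : A1 ρ) : Integrable ρ := by
  refine hρ.2.2.2.2.mono' hρ.1.aestronglyMeasurable (Eventually.of_forall fun x => ?_)
  have h0 := hρ.2.1 x
  rw [Real.norm_of_nonneg h0]
  nlinarith [mul_nonneg h0 (norm_nonneg x)]

theorem scaled_integrable {n : ℕ} {ρ : EV n → ℝ} (hρ : A1 ρ) {ε : ℝ} (hε : 0 < ε) :
    Integrable (scaled ρ ε) := by
  unfold scaled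
  exact ((rho_integrable hρ).comp_smul (inv_ne_zero hε.ne')).const_mul _

theorem scaled_integral {n : ℕ} {ρ : EV n → ℝ} {ε : ℝ} (hε : 0 < ε) :
    ∫ x, scaled ρ ε x = ∫ x, ρ x := by
  unfold scaled
  rw [integral_const_mul, Measure.integral_comp_smul]
  simp only [finrank_euclideanSpace, Fintype.card_fin, smul_eq_mul]
  rw [abs_of_pos (by positivity)]
  rw [inv_pow, inv_inv, ← mul_assoc, inv_mul_cancel₀ (by positivity), one_mul]

theorem kernel_mul_le {n : ℕ} {R : EV n → ℝ} (hR : ∀ x, 0 ≤ R x) (z : EV n) (c : ℝ) (hc : 0 ≤ c) :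
    ‖kernelJ R z‖ * (‖z‖ ^ 2 * c) ≤ R z * c := by
  unfold kernelJ
  rw [Real.norm_of_nonneg (div_nonneg (hR z) (by positivity)), ← mul_assoc]
  gcongr
  by_cases hz : ‖z‖ ^ 2 = 0
  · simp [hz, hR z]
  · rw [div_mul_cancel₀ _ hz]

theorem kernel_meas {n : ℕ} {R : EV n → ℝ} (hR : Measurable R) : Measurable (kernelJ R) := by
  unfold kernelJ
  exact hR.div (by fun_prop)

/-- joint measurability of the integrand -/
theorem integrand_meas {n : ℕ} {ρ : EV n → ℝ} (hρ : A1 ρ) (ε : ℝ) {u : EV n → ℝ}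
    (hu : ContDiff ℝ 2 u) : Measurable (fun q : EV n × EV n =>
      kernelJ (scaled ρ ε) (q.1 - q.2) * (u q.1 - u q.2 - fderiv ℝ u q.1 (q.1 - q.2))) := by
  have h1 : Measurable fun q : EV n × EV n => kernelJ (scaled ρ ε) (q.1 - q.2) :=
    (kernel_meas (scaled_meas hρ ε)).comp (measurable_fst.sub measurable_snd)
  have h2 : Continuous fun q : EV n × EV n => u q.1 - u q.2 - fderiv ℝ u q.1 (q.1 - q.2) := by
    have := hu.continuous
    have : Continuous fun q : EV n × EV n => fderiv ℝ u q.1 :=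
      (hu.continuous_fderiv two_ne_zero).comp continuous_fst
    fun_prop
  exact h1.mul h2.measurable

theorem integrand_integrable {n : ℕ} {ρ : EV n → ℝ} (hρ : A1 ρ) {ε : ℝ} (hε : 0 < ε)
    {u : EV n → ℝ} (hu : ContDiff ℝ 2 u) (hc : HasCompactSupport u) (x : EV n) :
    Integrable (fun y => kernelJ (scaled ρ ε) (x - y) * (u x - u y - fderiv ℝ u x (x - y))) := by
  obtain ⟨B, hB⟩ := hessSum_bdd hu hc
  have hi : Integrable fun y => scaled ρ ε (x - y) * B :=
    ((scaled_integrable hρ hε).comp_sub_left x).mul_const B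
  refine hi.mono' ((integrand_meas hρ ε hu).comp measurable_prodMk_left).aestronglyMeasurable
    (Eventually.of_forall fun y => ?_)
  have hB0 : 0 ≤ B := (hessSum_nonneg u x).trans (hB x)
  rw [norm_mul]
  refine le_trans ?_ (kernel_mul_le (scaled_nonneg hρ hε) (x - y) B hB0)
  gcongr
  have := taylor_bound hu x (x - y)
  rw [_root_.sub_sub_cancel] at this
  refine this.trans ?_
  gcongr
  have hcl : Continuous fun t : ℝ => x - t • (x - y) := by fun_prop
  calc ∫ t in (0:ℝ)..1, hessSum u (x - t • (x - y)) ≤ ∫ t in (0:ℝ)..1, B :=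
        intervalIntegral.integral_mono_on zero_le_one
          (((hessSum_cont hu).comp hcl).intervalIntegrable _ _) (by simp) (fun t _ => hB _)
    _ = B := by simp

theorem nlOp_lin {n : ℕ} {ρ : EV n → ℝ} (hρ : A1 ρ) {ε : ℝ} (hε : 0 < ε)
    {u v : EV n → ℝ} (hu : ContDiff ℝ 2 u) (huc : HasCompactSupport u)
    (hv : ContDiff ℝ 2 v) (hvc : HasCompactSupport v) (a b : ℝ) :
    nlOp ρ ε (fun x => a * u x + b * v x) = fun x => a * nlOp ρ ε u x + b * nlOp ρ ε v x := by
  ext x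
  unfold nlOp
  rw [← integral_const_mul, ← integral_const_mul, ← integral_add
    ((integrand_integrable hρ hε hu huc x).const_mul a)
    ((integrand_integrable hρ hε hv hvc x).const_mul b)]
  congr 1
  ext y
  have hdu := (hu.differentiable two_ne_zero) x
  have hdv := (hv.differentiable two_ne_zero) x
  rw [fderiv_fun_add (hdu.const_mul a) (hdv.const_mul b), fderiv_const_mul hdu, fderiv_const_mul hdv]
  simp only [_root_.add_apply, _root_.smul_apply, smul_eq_mul]
  ring

theorem nlOp_meas {n : ℕ} {ρ : EV n → ℝ} (hρ : A1 ρ) {ε : ℝ} {u : EV n → ℝ}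
    (hu : ContDiff ℝ 2 u) : StronglyMeasurable (nlOp ρ ε u) := by
  have := (integrand_meas hρ ε hu).stronglyMeasurable
  exact this.integral_prod_right'

theorem nlOp_enorm_le {n : ℕ} {ρ : EV n → ℝ} (hρ : A1 ρ) {ε : ℝ} (hε : 0 < ε)
    {u : EV n → ℝ} (hu : ContDiff ℝ 2 u) (x : EV n) :
    ‖nlOp ρ ε u x‖ₑ ≤ ∫⁻ w : EV n × ℝ, ENNReal.ofReal (hessSum u (x - w.2 • w.1))
      ∂((volume.withDensity fun z => ENNReal.ofReal (scaled ρ ε z)).prod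
        (volume.restrict (Set.Ioc (0:ℝ) 1))) := by
  have hRm : Measurable fun z => ENNReal.ofReal (scaled ρ ε z) := (scaled_meas hρ ε).ennreal_ofReal
  have hcont : Continuous fun w : EV n × ℝ => hessSum u (x - w.2 • w.1) :=
    (hessSum_cont hu).comp (by fun_prop)
  have hm : Measurable fun w : EV n × ℝ => ENNReal.ofReal (hessSum u (x - w.2 • w.1)) :=
    hcont.measurable.ennreal_ofReal
  rw [lintegral_prod _ hm.aemeasurable, lintegral_withDensity_eq_lintegral_mul _ hRm
    hm.lintegral_prod_right']
  unfold nlOp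
  refine (enorm_integral_le_lintegral_enorm _).trans ?_
  rw [← lintegral_sub_left_eq_self (μ := volume) _ x]
  refine lintegral_mono fun z => ?_
  simp only [_root_.sub_sub_cancel, Pi.mul_apply]
  have hcl : Continuous fun t : ℝ => hessSum u (x - t • z) := (hessSum_cont hu).comp (by fun_prop)
  have h1 : ∫⁻ t in Set.Ioc (0:ℝ) 1, ENNReal.ofReal (hessSum u (x - t • z)) =
      ENNReal.ofReal (∫ t in (0:ℝ)..1, hessSum u (x - t • z)) := by
    rw [intervalIntegral.integral_of_le zero_le_one, ofReal_integral_eq_lintegral_ofReal]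
    · exact (hcl.intervalIntegrable 0 1).1
    · exact Eventually.of_forall fun t => hessSum_nonneg _ _
  have h0 : 0 ≤ ∫ t in (0:ℝ)..1, hessSum u (x - t • z) :=
    intervalIntegral.integral_nonneg zero_le_one fun t _ => hessSum_nonneg _ _
  rw [h1, ← ENNReal.ofReal_mul (scaled_nonneg hρ hε z), ← ofReal_norm]
  apply ENNReal.ofReal_le_ofReal
  rw [norm_mul]
  refine le_trans ?_ (kernel_mul_le (scaled_nonneg hρ hε) z _ h0)
  gcongr
  exact taylor_bound hu x z

theorem nlOp_eLpNorm_le {n : ℕ} {ρ : EV n → ℝ} (hρ : A1 ρ) {ε : ℝ} (hε : 0 < ε)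
    {u : EV n → ℝ} (hu : ContDiff ℝ 2 u) (p : ℝ≥0∞) (hp1 : 1 ≤ p) (hp : p ≠ ⊤) :
    eLpNorm (nlOp ρ ε u) p volume ≤
      ENNReal.ofReal (∫ x, ρ x) * WNormD 2 p volume (fun l => partialDList l u) := by
  set ν := (volume : Measure (EV n)).withDensity fun z => ENNReal.ofReal (scaled ρ ε z) with hν
  have hνu : ν Set.univ = ENNReal.ofReal (∫ x, ρ x) := by
    rw [hν, withDensity_apply _ MeasurableSet.univ, Measure.restrict_univ,
      ← scaled_integral hε, ofReal_integral_eq_lintegral_ofReal (scaled_integrable hρ hε)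
      (Eventually.of_forall (scaled_nonneg hρ hε))]
  have : IsFiniteMeasure ν := ⟨by rw [hνu]; exact ENNReal.ofReal_lt_top⟩
  have hT : Measurable fun w : EV n × ℝ => w.2 • w.1 := measurable_snd.smul measurable_fst
  have key := aux_jensen (ν.prod (volume.restrict (Set.Ioc (0:ℝ) 1))) _ hT
    (fun x => ENNReal.ofReal (hessSum u x)) (hessSum_cont hu).measurable.ennreal_ofReal p hp1 hp
  have hmass : (ν.prod (volume.restrict (Set.Ioc (0:ℝ) 1))) Set.univ = ENNReal.ofReal (∫ x, ρ x) := by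
    rw [← Set.univ_prod_univ, Measure.prod_prod, hνu]; simp
  rw [hmass] at key
  refine (eLpNorm_mono_enorm (g := fun x => ∫⁻ w, ENNReal.ofReal (hessSum u (x - w.2 • w.1))
    ∂(ν.prod (volume.restrict (Set.Ioc (0:ℝ) 1)))) fun x => ?_).trans (key.trans ?_)
  · exact nlOp_enorm_le hρ hε hu x
  gcongr
  have e1 : eLpNorm (fun x => ENNReal.ofReal (hessSum u x)) p volume = eLpNorm
      (∑ q : Fin n × Fin n, fun x => ‖partialDList [q.1, q.2] u x‖) p volume := by
    apply eLpNorm_congr_enorm_ae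
    refine Eventually.of_forall fun x => ?_
    have : (∑ q : Fin n × Fin n, fun x => ‖partialDList [q.1, q.2] u x‖) x = hessSum u x := by
      rw [Finset.sum_apply, hessSum, Fintype.sum_prod_type]
    rw [this, Real.enorm_eq_ofReal (hessSum_nonneg _ _), enorm_eq_self]
  rw [e1]
  refine (eLpNorm_sum_le (fun q _ => ?_) hp1).trans ?_
  · exact (partialDList_cont hu [q.1, q.2] (by simp)).norm.aestronglyMeasurable
  simp only [eLpNorm_norm]
  rw [← tsum_fintype (L := .unconditional _)]
  have inj : Function.Injective fun q : Fin n × Fin n => [q.1, q.2] := by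
    rintro ⟨a, b⟩ ⟨c, d⟩ h; simpa using h
  have := ENNReal.tsum_comp_le_tsum_of_injective inj
    (fun l => if l.length ≤ 2 then eLpNorm (partialDList l u) p volume else 0)
  simpa [WNormD] using this

/-- mollification -/
def moll {n : ℕ} (φ : ContDiffBump (0 : EV n)) (f : EV n → ℝ) : EV n → ℝ :=
  convolution (φ.normed volume) f (ContinuousLinearMap.lsmul ℝ ℝ) volume

theorem moll_apply {n : ℕ} (φ : ContDiffBump (0 : EV n)) (f : EV n → ℝ) (x : EV n) :
    moll φ f x = ∫ t, φ.normed volume t * f (x - t) := rfl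

theorem moll_eLpNorm_le {n : ℕ} (φ : ContDiffBump (0 : EV n)) {f : EV n → ℝ}
    (hf : AEStronglyMeasurable f volume) (p : ℝ≥0∞) (hp1 : 1 ≤ p) (hp : p ≠ ⊤) :
    eLpNorm (moll φ f) p volume ≤ eLpNorm f p volume := by
  have hφm : Measurable fun t => ENNReal.ofReal (φ.normed volume t) :=
    φ.continuous_normed.measurable.ennreal_ofReal
  set ν := (volume : Measure (EV n)).withDensity fun t => ENNReal.ofReal (φ.normed volume t) with hν
  have hνu : ν Set.univ = 1 := by
    rw [hν, withDensity_apply _ MeasurableSet.univ, Measure.restrict_univ,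
      ← ofReal_integral_eq_lintegral_ofReal φ.integrable_normed
      (Eventually.of_forall φ.nonneg_normed), φ.integral_normed, ENNReal.ofReal_one]
  have : IsFiniteMeasure ν := ⟨by rw [hνu]; exact ENNReal.one_lt_top⟩
  have hmk : moll φ f = moll φ (hf.mk f) := convolution_congr _ (ae_eq_refl _) hf.ae_eq_mk
  have hm : Measurable fun x => ‖hf.mk f x‖ₑ := hf.stronglyMeasurable_mk.measurable.enorm
  have key := aux_jensen ν (fun t : EV n => t) measurable_id _ hm p hp1 hp
  rw [hνu, one_mul] at key
  rw [eLpNorm_congr_ae hf.ae_eq_mk, hmk]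
  have e : eLpNorm (fun x => ‖hf.mk f x‖ₑ) p volume = eLpNorm (hf.mk f) p volume :=
    eLpNorm_congr_enorm_ae (Eventually.of_forall fun x => by simp)
  rw [e] at key
  refine (eLpNorm_mono_enorm fun x => ?_).trans key
  rw [enorm_eq_self, moll_apply]
  refine (enorm_integral_le_lintegral_enorm _).trans (le_of_eq ?_)
  have hm' : Measurable fun w => ‖hf.mk f (x - w)‖ₑ := hm.comp (measurable_const.sub measurable_id)
  rw [hν, lintegral_withDensity_eq_lintegral_mul _ hφm hm']
  refine lintegral_congr fun t => ?_
  rw [enorm_mul, Real.enorm_eq_ofReal (φ.nonneg_normed t)]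
  rfl

theorem moll_sub {n : ℕ} (φ : ContDiffBump (0 : EV n)) {f g : EV n → ℝ}
    (hf : LocallyIntegrable f volume) (hg : LocallyIntegrable g volume) :
    moll φ (f - g) = moll φ f - moll φ g := by
  have ex := fun {h : EV n → ℝ} (hh : LocallyIntegrable h volume) =>
    φ.hasCompactSupport_normed.convolutionExists_left (μ := (volume : Measure (EV n)))
      (ContinuousLinearMap.lsmul ℝ ℝ) (φ.continuous_normed (μ := volume)) hh
  have h := (ex (hf.sub hg)).distrib_add (ex hg)
  rw [sub_add_cancel] at h
  unfold moll
  rw [h, add_sub_cancel_right]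

theorem moll_contDiff {n : ℕ} (φ : ContDiffBump (0 : EV n)) {f : EV n → ℝ}
    (hf : LocallyIntegrable f volume) : ContDiff ℝ 2 (moll φ f) := by
  have := φ.hasCompactSupport_normed.contDiff_convolution_left (n := 2)
    (ContinuousLinearMap.lsmul ℝ ℝ) (φ.contDiff_normed (μ := (volume : Measure (EV n)))) hf
  exact_mod_cast this

theorem moll_close_cont {n : ℕ} {g : EV n → ℝ} (hg : Continuous g) (hgc : HasCompactSupport g)
    (p : ℝ≥0∞) (hp : p ≠ ⊤) {δ : ℝ≥0∞} (hδ : δ ≠ 0) :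
    ∃ r : ℝ, 0 < r ∧ ∀ φ : ContDiffBump (0 : EV n), φ.rOut ≤ r →
      eLpNorm (moll φ g - g) p volume ≤ δ := by
  set s := Metric.cthickening 1 (tsupport g) with hs
  have hscomp : IsCompact s := hgc.isCompact.cthickening
  have hM : volume s ^ (1 / p.toReal) ≠ ⊤ :=
    ENNReal.rpow_ne_top_of_nonneg (by positivity) hscomp.measure_lt_top.ne
  obtain ⟨η, hη0, hη⟩ := ENNReal.exists_nnreal_pos_mul_lt hM hδ
  have huc := hgc.uniformContinuous_of_continuous hg
  rw [Metric.uniformContinuous_iff] at huc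
  obtain ⟨r, hr0, hr⟩ := huc η (by exact_mod_cast hη0)
  refine ⟨min r 1, by positivity, fun φ hφ => ?_⟩
  refine (eLpNorm_sub_le_of_dist_bdd volume hp hscomp.measurableSet η.2 (s := s) ?_ ?_ ?_).trans
    (by simpa using hη.le)
  · intro x
    refine φ.dist_normed_convolution_le hg.aestronglyMeasurable fun y hy => (hr ?_).le
    exact (Metric.mem_ball.1 hy).trans_le (hφ.trans (min_le_left _ _))
  · refine (support_convolution_subset (ContinuousLinearMap.lsmul ℝ ℝ)).trans ?_
    rintro _ ⟨a, ha, b, hb, rfl⟩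
    rw [φ.support_normed_eq, mem_ball_zero_iff] at ha
    refine Metric.mem_cthickening_of_dist_le _ b _ _ (subset_tsupport _ hb) ?_
    simp only [dist_add_self_left]
    exact ha.le.trans (hφ.trans (min_le_right _ _))
  · exact (subset_tsupport g).trans (Metric.self_subset_cthickening _)

theorem moll_close {n : ℕ} {f : EV n → ℝ} (p : ℝ≥0∞) (hp1 : 1 ≤ p) (hp : p ≠ ⊤)
    (hf : MemLp f p volume) {δ : ℝ≥0∞} (hδ : δ ≠ 0) :
    ∃ r : ℝ, 0 < r ∧ ∀ φ : ContDiffBump (0 : EV n), φ.rOut ≤ r →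
      eLpNorm (moll φ f - f) p volume ≤ δ := by
  have hδ3 : δ / 3 ≠ 0 := by simp [hδ]
  obtain ⟨g, hgc, hfg, hg, hgL⟩ := hf.exists_hasCompactSupport_eLpNorm_sub_le hp hδ3
  obtain ⟨r, hr0, hr⟩ := moll_close_cont hg hgc p hp hδ3
  refine ⟨r, hr0, fun φ hφ => ?_⟩
  have hl := hf.locallyIntegrable hp1
  have hl' := hgL.locallyIntegrable hp1
  have e : moll φ f - f = (moll φ (f - g) + (moll φ g - g)) + (g - f) := by
    rw [moll_sub φ hl hl']; abel
  have m1 : AEStronglyMeasurable (moll φ (f - g)) volume :=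
    (moll_contDiff φ (hl.sub hl')).continuous.aestronglyMeasurable
  have m2 : AEStronglyMeasurable (moll φ g - g) volume :=
    ((moll_contDiff φ hl').continuous.sub hg).aestronglyMeasurable
  rw [e]
  calc _ ≤ (eLpNorm (moll φ (f - g)) p volume + eLpNorm (moll φ g - g) p volume)
        + eLpNorm (g - f) p volume :=
        (eLpNorm_add_le (m1.add m2) (hgL.1.sub hf.1) hp1).trans
          (add_le_add_left (eLpNorm_add_le m1 m2 hp1) _)
    _ ≤ (δ / 3 + δ / 3) + δ / 3 := by
        gcongr
        · exact (moll_eLpNorm_le φ (hf.1.sub hgL.1) p hp1 hp).trans hfg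
        · exact hr φ hφ
        · rw [eLpNorm_sub_comm]; exact hfg
    _ = δ := ENNReal.add_thirds δ

theorem moll_partialD {n : ℕ} (φ : ContDiffBump (0 : EV n)) {f g : EV n → ℝ} {i : Fin n}
    (hf : LocallyIntegrable f volume) (h : WeakDerivOn Set.univ i f g) :
    partialD i (moll φ f) = moll φ g := by
  ext x
  set ψ := φ.normed (volume : Measure (EV n)) with hψ
  have hψs : ContDiff ℝ (⊤ : ℕ∞) ψ := φ.contDiff_normed
  have hψc : HasCompactSupport ψ := φ.hasCompactSupport_normed
  have hder := hψc.hasFDerivAt_convolution_left (μ := volume) (ContinuousLinearMap.lsmul ℝ ℝ)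
    (φ.contDiff_normed (n := 1)) hf x
  have hex := (hψc.fderiv (𝕜 := ℝ)).convolutionExists_left (μ := volume)
    ((ContinuousLinearMap.lsmul ℝ ℝ : ℝ →L[ℝ] ℝ →L[ℝ] ℝ).precompL (EV n))
    (hψs.continuous_fderiv (by simp)) hf x
  have e1 : partialD i (moll φ f) x = ∫ t, partialD i ψ t * f (x - t) := by
    unfold partialD moll
    rw [hder.fderiv, convolution, ContinuousLinearMap.integral_apply hex]
    simp
  have hτ : ContDiff ℝ (⊤ : ℕ∞) fun t => ψ (x - t) := hψs.comp (contDiff_const.sub contDiff_id)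
  have hτc : HasCompactSupport fun t => ψ (x - t) :=
    hψc.comp_homeomorph (Homeomorph.subLeft x)
  have hτd : ∀ t, partialD i (fun t => ψ (x - t)) t = - partialD i ψ (x - t) := by
    intro t
    have a : HasFDerivAt ψ (fderiv ℝ ψ (x - t)) (x - t) :=
      ((hψs.differentiable (by simp)) _).hasFDerivAt
    have b := a.comp t ((hasFDerivAt_id t).const_sub x)
    have : fderiv ℝ (fun t => ψ (x - t)) t = _ := b.fderiv
    unfold partialD
    rw [this]
    simp
  have hw := h _ hτ hτc (Set.subset_univ _)
  simp only [Measure.restrict_univ, hτd] at hw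
  rw [e1, moll_apply, ← integral_sub_left_eq_self _ volume x, ← integral_sub_left_eq_self
    (fun t => φ.normed volume t * g (x - t)) volume x]
  simp only [_root_.sub_sub_cancel]
  have : ∫ t, f t * -partialD i ψ (x - t) = - ∫ t, partialD i ψ (x - t) * f t := by
    rw [← integral_neg]; congr 1; ext t; ring
  rw [this, neg_inj] at hw
  rw [hw]
  congr 1; ext t; rw [mul_comm]

theorem moll_partialDList {n : ℕ} (φ : ContDiffBump (0 : EV n)) {u : EV n → ℝ} {p : ℝ≥0∞}
    (hp1 : 1 ≤ p) {D : List (Fin n) → EV n → ℝ} (hD : IsSobDerivs Set.univ 2 p u D)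
    (l : List (Fin n)) (hl : l.length ≤ 2) : partialDList l (moll φ u) = moll φ (D l) := by
  induction l with
  | nil => rw [hD.1]; rfl
  | cons i l ih =>
    simp only [List.length_cons] at hl
    have h1 := hD.2.2 l (by omega)
    rw [Measure.restrict_univ] at h1
    rw [partialDList, ih (by omega)]
    exact moll_partialD φ (h1.locallyIntegrable hp1) (hD.2.1 l (by omega) i)

theorem WNormD_eq {n : ℕ} (p : ℝ≥0∞) (D : List (Fin n) → EV n → ℝ) :
    WNormD 2 p volume D =
      ∑ l ∈ (List.finite_length_le (Fin n) 2).toFinset, eLpNorm (D l) p volume := by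
  unfold WNormD
  rw [tsum_eq_sum (s := (List.finite_length_le (Fin n) 2).toFinset)]
  · refine Finset.sum_congr rfl fun l hl => ?_
    rw [if_pos (by simpa using hl)]
  · intro l hl
    rw [if_neg (by simpa using hl)]

theorem WNormD_small {n : ℕ} (p : ℝ≥0∞) {δ : ℝ≥0∞} (hδ : δ ≠ 0) : ∃ η : ℝ≥0∞, η ≠ 0 ∧ 
    ∀ D : List (Fin n) → EV n → ℝ, (∀ l, l.length ≤ 2 → eLpNorm (D l) p volume ≤ η) →
      WNormD 2 p volume D ≤ δ := by
  set N := (List.finite_length_le (Fin n) 2).toFinset.card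
  obtain ⟨η, h0, hη⟩ := ENNReal.exists_nnreal_pos_mul_lt (ENNReal.natCast_ne_top N) hδ
  refine ⟨η, by exact_mod_cast h0.ne', fun D hD => ?_⟩
  rw [WNormD_eq]
  refine (Finset.sum_le_card_nsmul _ _ (η : ℝ≥0∞) fun l hl => hD l (by simpa using hl)).trans ?_
  rw [nsmul_eq_mul, mul_comm]
  exact hη.le

theorem WNormD_add_le {n : ℕ} (p : ℝ≥0∞) (hp1 : 1 ≤ p) {A B : List (Fin n) → EV n → ℝ}
    (hA : ∀ l, l.length ≤ 2 → AEStronglyMeasurable (A l) volume)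
    (hB : ∀ l, l.length ≤ 2 → AEStronglyMeasurable (B l) volume) :
    WNormD 2 p volume (fun l => A l + B l) ≤ WNormD 2 p volume A + WNormD 2 p volume B := by
  simp only [WNormD_eq]
  rw [← Finset.sum_add_distrib]
  refine Finset.sum_le_sum fun l hl => ?_
  have hl : l.length ≤ 2 := by simpa using hl
  exact eLpNorm_add_le (hA l hl) (hB l hl) hp1

theorem WNormD_congr {n : ℕ} (p : ℝ≥0∞) {A B : List (Fin n) → EV n → ℝ}
    (h : ∀ l, l.length ≤ 2 → eLpNorm (A l) p volume = eLpNorm (B l) p volume) :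
    WNormD 2 p volume A = WNormD 2 p volume B := by
  simp only [WNormD_eq]
  exact Finset.sum_congr rfl fun l hl => h l (by simpa using hl)

theorem exists_smooth {n : ℕ} {u : EV n → ℝ} {p : ℝ≥0∞}
    (hp1 : 1 ≤ p) (hp : p ≠ ⊤) {D : List (Fin n) → EV n → ℝ} (hD : IsSobDerivs Set.univ 2 p u D)
    {δ : ℝ≥0∞} (hδ : δ ≠ 0) : ∃ v : EV n → ℝ, ContDiff ℝ 2 v ∧
      (∀ l, l.length ≤ 2 → MemLp (partialDList l v) p volume) ∧
      WNormD 2 p volume (fun l => D l - partialDList l v) ≤ δ := by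
  obtain ⟨η, h0, hη⟩ := WNormD_small (n := n) p hδ
  have hL : ∀ l : List (Fin n), l.length ≤ 2 → MemLp (D l) p volume := fun l hl => by
    have := hD.2.2 l hl
    rwa [Measure.restrict_univ] at this
  have h : ∀ l : List (Fin n), ∃ r : ℝ, 0 < r ∧ (l.length ≤ 2 → ∀ φ : ContDiffBump (0 : EV n),
      φ.rOut ≤ r → eLpNorm (moll φ (D l) - D l) p volume ≤ η) := fun l => by
    by_cases hl : l.length ≤ 2
    · obtain ⟨r, hr, h⟩ := moll_close p hp1 hp (hL l hl) h0
      exact ⟨r, hr, fun _ => h⟩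
    · exact ⟨1, one_pos, fun h => absurd h hl⟩
  choose r hr0 hr using h
  obtain ⟨R, hR0, hR⟩ : ∃ R : ℝ, 0 < R ∧ ∀ l : List (Fin n), l.length ≤ 2 → R ≤ r l := by
    have hne : (List.finite_length_le (Fin n) 2).toFinset.Nonempty := ⟨[], by simp⟩
    refine ⟨(List.finite_length_le (Fin n) 2).toFinset.inf' hne r, ?_,
      fun l hl => Finset.inf'_le r (by simpa using hl)⟩
    rw [Finset.lt_inf'_iff]
    exact fun l _ => hr0 l
  let φ : ContDiffBump (0 : EV n) := ⟨R / 2, R, by positivity, by linarith⟩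
  have hl0 : LocallyIntegrable u volume := by
    have := (hL [] (by simp)).locallyIntegrable hp1
    rwa [hD.1] at this
  refine ⟨moll φ u, moll_contDiff φ hl0, fun l hl => ?_, hη _ fun l hl => ?_⟩
  · rw [moll_partialDList φ hp1 hD l hl]
    exact ⟨(moll_contDiff φ ((hL l hl).locallyIntegrable hp1)).continuous.aestronglyMeasurable,
      (moll_eLpNorm_le φ (hL l hl).1 p hp1 hp).trans_lt (hL l hl).2⟩
  · rw [moll_partialDList φ hp1 hD l hl, eLpNorm_sub_comm]
    exact hr l hl φ (hR l hl)

theorem partialD_mul {n : ℕ} {f g : EV n → ℝ} (hf : Differentiable ℝ f) (hg : Differentiable ℝ g)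
    (i : Fin n) : partialD i (fun x => f x * g x) =
      fun x => partialD i f x * g x + f x * partialD i g x := by
  ext x
  unfold partialD
  rw [fderiv_fun_mul (hf x) (hg x)]
  simp only [_root_.add_apply, _root_.smul_apply, smul_eq_mul]
  ring

theorem partialD_add {n : ℕ} {f g : EV n → ℝ} (hf : Differentiable ℝ f) (hg : Differentiable ℝ g)
    (i : Fin n) : partialD i (fun x => f x + g x) =
      fun x => partialD i f x + partialD i g x := by
  ext x
  unfold partialD
  rw [fderiv_fun_add (hf x) (hg x)]
  simp only [_root_.add_apply]

theorem partialD_lin {n : ℕ} {f g : EV n → ℝ} (hf : Differentiable ℝ f) (hg : Differentiable ℝ g)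
    (a b : ℝ) (i : Fin n) : partialD i (fun x => a * f x + b * g x) =
      fun x => a * partialD i f x + b * partialD i g x := by
  ext x
  unfold partialD
  rw [fderiv_fun_add ((hf x).const_mul a) ((hg x).const_mul b), fderiv_const_mul (hf x),
    fderiv_const_mul (hg x)]
  simp only [_root_.add_apply, _root_.smul_apply, smul_eq_mul]

theorem partialDList_smooth {n : ℕ} {u : EV n → ℝ} (hu : ContDiff ℝ (⊤ : ℕ∞) u)
    (l : List (Fin n)) : ContDiff ℝ (⊤ : ℕ∞) (partialDList l u) := by
  induction l with
  | nil => exact hu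
  | cons i l ih => exact partialD_contDiff ih (by simp) i

theorem partialDList_scale {n : ℕ} {g : EV n → ℝ} (hg : ContDiff ℝ (⊤ : ℕ∞) g) (c : ℝ)
    (l : List (Fin n)) : partialDList l (fun x => g (c • x)) =
      fun x => c ^ l.length * partialDList l g (c • x) := by
  induction l with
  | nil => simp [partialDList]
  | cons i l ih =>
    rw [partialDList, ih]
    ext x
    have hd : DifferentiableAt ℝ (partialDList l g) (c • x) :=
      ((partialDList_smooth hg l).differentiable (by simp)) _
    have h1 : HasFDerivAt (fun x : EV n => c • x) (c • ContinuousLinearMap.id ℝ (EV n)) x :=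
      (hasFDerivAt_id x).const_smul c
    have h2 := (hd.hasFDerivAt.comp x h1).const_mul (c ^ l.length)
    have h3 : fderiv ℝ (fun x => c ^ l.length * partialDList l g (c • x)) x = _ := h2.fderiv
    rw [partialD, h3, partialDList, partialD]
    simp [pow_succ]
    ring

/-- the base cutoff -/
def chi (n : ℕ) : ContDiffBump (0 : EV n) := ⟨1, 2, one_pos, one_lt_two⟩

theorem chi_near {n : ℕ} (l : List (Fin n)) (y : EV n) (hy : y ∈ Metric.ball (0 : EV n) 1) :
    partialDList l (chi n) y = if l = [] then 1 else 0 := by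
  induction l generalizing y with
  | nil =>
    simp only [partialDList, if_true]
    exact (chi n).one_of_mem_closedBall (Metric.ball_subset_closedBall hy)
  | cons i l ih =>
    have : partialDList l (chi n) =ᶠ[𝓝 y] fun _ => (if l = [] then 1 else 0 : ℝ) := by
      filter_upwards [Metric.isOpen_ball.mem_nhds hy] with z hz using ih z hz
    rw [partialDList, partialD, this.fderiv_eq]
    simp

/-- the cutoff sequence -/
def cut (n : ℕ) (k : ℕ) (x : EV n) : ℝ := chi n (((k : ℝ) + 1)⁻¹ • x)

theorem cut_smooth (n k : ℕ) : ContDiff ℝ (⊤ : ℕ∞) (cut n k) :=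
  (chi n).contDiff.comp (contDiff_const_smul _)

theorem cut_compact (n k : ℕ) : HasCompactSupport (cut n k) :=
  (chi n).hasCompactSupport.comp_homeomorph (Homeomorph.smulOfNeZero ((k : ℝ) + 1)⁻¹ (by positivity))

theorem cut_eq {n : ℕ} (k : ℕ) (l : List (Fin n)) : partialDList l (cut n k) =
    fun x => (((k : ℝ) + 1)⁻¹) ^ l.length * partialDList l (chi n) (((k : ℝ) + 1)⁻¹ • x) :=
  partialDList_scale (chi n).contDiff _ l

theorem cut_bound {n : ℕ} (l : List (Fin n)) : ∃ B : ℝ, ∀ k x, ‖partialDList l (cut n k) x‖ ≤ B := by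
  obtain ⟨B, hB⟩ := (partialDList_compact (chi n).hasCompactSupport l).exists_bound_of_continuous
    (partialDList_smooth (chi n).contDiff l).continuous
  refine ⟨B, fun k x => ?_⟩
  rw [cut_eq, norm_mul]
  have h1 : ‖(((k : ℝ) + 1)⁻¹) ^ l.length‖ ≤ 1 := by
    rw [norm_pow, Real.norm_of_nonneg (by positivity)]
    refine pow_le_one₀ (by positivity) (inv_le_one_of_one_le₀ ?_)
    have : (0:ℝ) ≤ k := k.cast_nonneg
    linarith
  calc _ ≤ 1 * B := by
        gcongr
        exact hB _
    _ = B := one_mul B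

theorem cut_ev {n : ℕ} (l : List (Fin n)) (x : EV n) :
    ∀ᶠ k : ℕ in atTop, partialDList l (cut n k) x = if l = [] then 1 else 0 := by
  obtain ⟨N, hN⟩ := exists_nat_ge ‖x‖
  filter_upwards [eventually_ge_atTop N] with k hk
  have hk' : (N : ℝ) ≤ k := by exact_mod_cast hk
  rw [cut_eq]
  simp only
  rw [chi_near]
  · by_cases h : l = [] <;> simp [h]
  · rw [mem_ball_zero_iff, norm_smul, Real.norm_of_nonneg (by positivity), inv_mul_lt_iff₀ (by positivity)]
    linarith

/-- bounded sequences of continuous functions that vanish eventually pointwise -/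
def Good {n : ℕ} (ψ : ℕ → EV n → ℝ) : Prop :=
  (∀ k, Continuous (ψ k)) ∧ (∃ B : ℝ, ∀ k x, ‖ψ k x‖ ≤ B) ∧ ∀ x, ∀ᶠ k in atTop, ψ k x = 0

theorem good_one_sub {n : ℕ} : Good (fun k x => 1 - cut n k x) := by
  refine ⟨fun k => continuous_const.sub (cut_smooth n k).continuous, ?_, fun x => ?_⟩
  · obtain ⟨B, hB⟩ := cut_bound (n := n) []
    refine ⟨1 + B, fun k x => (norm_sub_le _ _).trans ?_⟩
    have : ‖cut n k x‖ ≤ B := hB k x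
    rw [norm_one]
    linarith
  · filter_upwards [cut_ev [] x] with k hk
    simp only [partialDList, if_true] at hk
    rw [hk, sub_self]

theorem good_neg {n : ℕ} (l : List (Fin n)) (hl : l ≠ []) :
    Good (fun k x => - partialDList l (cut n k) x) := by
  refine ⟨fun k => (partialDList_smooth (cut_smooth n k) l).continuous.neg, ?_, fun x => ?_⟩
  · obtain ⟨B, hB⟩ := cut_bound l
    exact ⟨B, fun k x => by simpa using hB k x⟩
  · filter_upwards [cut_ev l x] with k hk
    simp [hk, hl]

theorem good_tendsto {n : ℕ} {ψ : ℕ → EV n → ℝ} (hψ : Good ψ) {f : EV n → ℝ} {p : ℝ≥0∞}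
    (hp1 : 1 ≤ p) (hp : p ≠ ⊤) (hf : MemLp f p volume) :
    Tendsto (fun k => eLpNorm (fun x => ψ k x * f x) p volume) atTop (𝓝 0) := by
  obtain ⟨hc, ⟨B, hB⟩, hev⟩ := hψ
  have hp0 : p ≠ 0 := (zero_lt_one.trans_le hp1).ne'
  have hq0 : 0 < p.toReal := ENNReal.toReal_pos hp0 hp
  simp only [eLpNorm_eq_lintegral_rpow_enorm_toReal hp0 hp]
  have hB' : MemLp (fun x => B * f x) p volume := hf.const_mul B
  have key : Tendsto (fun k => ∫⁻ x, ‖ψ k x * f x‖ₑ ^ p.toReal) atTop (𝓝 (∫⁻ x : EV n, 0)) := by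
    refine tendsto_lintegral_of_dominated_convergence' (fun x => ‖B * f x‖ₑ ^ p.toReal)
      (fun k => ?_) (fun k => ?_) ?_ ?_
    · exact ((hc k).aestronglyMeasurable.mul hf.1).enorm.pow_const _
    · refine Eventually.of_forall fun x => ?_
      refine ENNReal.rpow_le_rpow ?_ hq0.le
      rw [enorm_mul, enorm_mul]
      gcongr
      rw [enorm_le_iff_norm_le]
      exact (hB k x).trans (le_abs_self B)
    · exact (lintegral_rpow_enorm_lt_top_of_eLpNorm_lt_top hp0 hp hB'.2).ne
    · refine Eventually.of_forall fun x => tendsto_const_nhds.congr' ?_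
      filter_upwards [hev x] with k hk
      simp [hk, hq0]
  have := (ENNReal.continuous_rpow_const (y := 1 / p.toReal)).tendsto _ |>.comp key
  simpa [Function.comp_def, hq0, ENNReal.zero_rpow_of_pos] using this

theorem tendsto_eLpNorm_add {n : ℕ} {F G : ℕ → EV n → ℝ} {p : ℝ≥0∞} (hp1 : 1 ≤ p)
    (hF : ∀ k, AEStronglyMeasurable (F k) volume) (hG : ∀ k, AEStronglyMeasurable (G k) volume)
    (h1 : Tendsto (fun k => eLpNorm (F k) p volume) atTop (𝓝 0))
    (h2 : Tendsto (fun k => eLpNorm (G k) p volume) atTop (𝓝 0)) :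
    Tendsto (fun k => eLpNorm (F k + G k) p volume) atTop (𝓝 0) := by
  refine tendsto_of_tendsto_of_tendsto_of_le_of_le tendsto_const_nhds (by simpa using h1.add h2)
    (fun _ => zero_le) (fun k => eLpNorm_add_le (hF k) (hG k) hp1)

theorem cut_tendsto {n : ℕ} {v : EV n → ℝ} {p : ℝ≥0∞} (hp1 : 1 ≤ p) (hp : p ≠ ⊤)
    (hv : ContDiff ℝ 2 v) (hL : ∀ l, l.length ≤ 2 → MemLp (partialDList l v) p volume)
    (l : List (Fin n)) (hl : l.length ≤ 2) :
    Tendsto (fun k => eLpNorm (partialDList l v - partialDList l (fun x => v x * cut n k x)) p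
      volume) atTop (𝓝 0) := by
  have T := fun {ψ : ℕ → EV n → ℝ} (hψ : Good ψ) (l : List (Fin n)) (hl : l.length ≤ 2) =>
    good_tendsto hψ hp1 hp (hL l hl)
  have M := fun {ψ : ℕ → EV n → ℝ} (hψ : Good ψ) (l : List (Fin n)) (hl : l.length ≤ 2) (k : ℕ) =>
    (((hψ.1 k).aestronglyMeasurable (μ := volume)).mul (hL l hl).1 :
      AEStronglyMeasurable (fun x => ψ k x * partialDList l v x) volume)
  have dv : Differentiable ℝ v := hv.differentiable two_ne_zero
  have dc : ∀ k l, Differentiable ℝ (partialDList l (cut n k)) := fun k l =>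
    (partialDList_smooth (cut_smooth n k) l).differentiable (by simp)
  have dv1 : ∀ i, Differentiable ℝ (partialDList [i] v) := fun i =>
    (partialDList_contDiff hv [i] (by simp)).differentiable (by simp)
  have e1 : ∀ k j, partialDList [j] (fun x => v x * cut n k x) = fun x =>
      partialDList [j] v x * cut n k x + v x * partialDList [j] (cut n k) x := fun k j =>
    partialD_mul dv (dc k []) j
  have e2 : ∀ k i j, partialDList [i, j] (fun x => v x * cut n k x) = fun x =>
      (partialDList [i, j] v x * cut n k x + partialDList [j] v x * partialDList [i] (cut n k) x) +
      (partialDList [i] v x * partialDList [j] (cut n k) x +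
        v x * partialDList [i, j] (cut n k) x) := fun k i j => by
    have : partialDList [i, j] (fun x => v x * cut n k x) =
      partialD i (partialDList [j] (fun x => v x * cut n k x)) := rfl
    have dc0 : Differentiable ℝ (cut n k) := dc k []
    rw [this, e1, partialD_add (f := fun x => partialDList [j] v x * cut n k x)
      (g := fun x => v x * partialDList [j] (cut n k) x) ((dv1 j).mul dc0) (dv.mul (dc k [j])),
      partialD_mul (dv1 j) dc0, partialD_mul dv (dc k [j])]
    rfl
  match l, hl with
  | [], _ =>
    refine (T good_one_sub [] (by simp)).congr fun k => ?_
    congr 1; ext x; simp only [partialDList, Pi.sub_apply]; ring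
  | [j], _ =>
    refine (tendsto_eLpNorm_add hp1 (M good_one_sub [j] (by simp))
      (M (good_neg [j] (by simp)) [] (by simp))
      (T good_one_sub [j] (by simp)) (T (good_neg [j] (by simp)) [] (by simp))).congr fun k => ?_
    congr 1; ext x; rw [e1]; simp only [Pi.add_apply, Pi.sub_apply, Pi.mul_apply]
    rw [show partialDList [] v = v from rfl]; ring
  | [i, j], _ =>
    have a1 := tendsto_eLpNorm_add hp1 (M good_one_sub [i, j] (by simp))
      (M (good_neg [i] (by simp)) [j] (by simp))
      (T good_one_sub [i, j] (by simp)) (T (good_neg [i] (by simp)) [j] (by simp))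
    have a2 := tendsto_eLpNorm_add hp1 (M (good_neg [j] (by simp)) [i] (by simp))
      (M (good_neg [i, j] (by simp)) [] (by simp))
      (T (good_neg [j] (by simp)) [i] (by simp)) (T (good_neg [i, j] (by simp)) [] (by simp))
    refine (tendsto_eLpNorm_add hp1
      (fun k => (M good_one_sub [i, j] (by simp) k).add (M (good_neg [i] (by simp)) [j] (by simp) k))
      (fun k => (M (good_neg [j] (by simp)) [i] (by simp) k).add
        (M (good_neg [i, j] (by simp)) [] (by simp) k)) a1 a2).congr fun k => ?_
    congr 1; ext x; rw [e2]; simp only [Pi.add_apply, Pi.sub_apply, Pi.mul_apply]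
    rw [show partialDList [] v = v from rfl]; ring
  | _ :: _ :: _ :: _, h => simp at h

theorem partialDList_aesm {n : ℕ} {v : EV n → ℝ} (hv : ContDiff ℝ 2 v) (l : List (Fin n))
    (hl : l.length ≤ 2) : AEStronglyMeasurable (partialDList l v) volume :=
  (partialDList_cont hv l hl).aestronglyMeasurable

theorem density {n : ℕ} {u : EV n → ℝ} {p : ℝ≥0∞}
    (hp1 : 1 ≤ p) (hp : p ≠ ⊤) {D : List (Fin n) → EV n → ℝ} (hD : IsSobDerivs Set.univ 2 p u D)
    {δ : ℝ≥0∞} (hδ : δ ≠ 0) : ∃ v : EV n → ℝ, ContDiff ℝ 2 v ∧ HasCompactSupport v ∧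
      WNormD 2 p volume (fun l => D l - partialDList l v) ≤ δ := by
  have hδ2 : δ / 2 ≠ 0 := by simp [hδ]
  obtain ⟨v, hv, hL, hvD⟩ := exists_smooth hp1 hp hD hδ2
  have ht : Tendsto (fun k => WNormD 2 p volume (fun l => partialDList l v -
      partialDList l (fun x => v x * cut n k x))) atTop (𝓝 0) := by
    simp only [WNormD_eq]
    have := tendsto_finsetSum (List.finite_length_le (Fin n) 2).toFinset fun l hl =>
      cut_tendsto hp1 hp hv hL l (by simpa using hl)
    simpa using this
  obtain ⟨k, hk⟩ := (ht.eventually_lt_const (pos_iff_ne_zero.2 hδ2)).exists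
  have hw : ContDiff ℝ 2 (fun x => v x * cut n k x) :=
    hv.mul (contDiff_infty.1 (cut_smooth n k) 2)
  refine ⟨fun x => v x * cut n k x, hw, (cut_compact n k).mul_left, ?_⟩
  have hDm : ∀ l : List (Fin n), l.length ≤ 2 → AEStronglyMeasurable (D l) volume := fun l hl => by
    have := (hD.2.2 l hl).1
    rwa [Measure.restrict_univ] at this
  have := WNormD_add_le p hp1 (A := fun l => D l - partialDList l v)
    (B := fun l => partialDList l v - partialDList l (fun x => v x * cut n k x))
    (fun l hl => (hDm l hl).sub (partialDList_aesm hv l hl))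
    (fun l hl => (partialDList_aesm hv l hl).sub (partialDList_aesm hw l hl))
  simp only [sub_add_sub_cancel] at this
  calc _ ≤ _ := this
    _ ≤ δ / 2 + δ / 2 := add_le_add hvD hk.le
    _ = δ := ENNReal.add_halves δ

theorem partialDList_lin {n : ℕ} {u v : EV n → ℝ} (hu : ContDiff ℝ 2 u) (hv : ContDiff ℝ 2 v)
    (a b : ℝ) (l : List (Fin n)) (hl : l.length ≤ 2) :
    partialDList l (fun x => a * u x + b * v x) =
      fun x => a * partialDList l u x + b * partialDList l v x := by
  induction l with
  | nil => rfl
  | cons i l ih =>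
    have hl1 : l.length + 1 ≤ 2 := by simpa using hl
    have hne : (((2 - l.length : ℕ) : ℕ∞) : WithTop ℕ∞) ≠ 0 := by
      have : 2 - l.length ≠ 0 := by omega
      exact_mod_cast this
    have du := (partialDList_contDiff hu l (by omega)).differentiable hne
    have dv := (partialDList_contDiff hv l (by omega)).differentiable hne
    rw [partialDList, ih (by omega), partialD_lin du dv]
    rfl

theorem sob_memLp {n : ℕ} {u : EV n → ℝ} {p : ℝ≥0∞} {D : List (Fin n) → EV n → ℝ}
    (hD : IsSobDerivs Set.univ 2 p u D) (l : List (Fin n)) (hl : l.length ≤ 2) :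
    MemLp (D l) p volume := by
  have := hD.2.2 l hl
  rwa [Measure.restrict_univ] at this

theorem sob_classical {n : ℕ} {u : EV n → ℝ} (p : ℝ≥0∞) (hu : ContDiff ℝ 2 u)
    (huc : HasCompactSupport u) :
    IsSobDerivs Set.univ 2 p u (fun l => partialDList l u) := by
  refine ⟨rfl, fun l hl i φ hφ hφc _ => ?_, fun l hl => ?_⟩
  · rw [Measure.restrict_univ]
    have hne : (((2 - l.length : ℕ) : ℕ∞) : WithTop ℕ∞) ≠ 0 := by
      have : 2 - l.length ≠ 0 := by omega
      exact_mod_cast this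
    have du := (partialDList_contDiff hu l hl.le).differentiable hne
    have cu := partialDList_cont hu l hl.le
    have cu' := partialDList_cont hu (i :: l) (by simpa using hl)
    have cφ' : Continuous (partialD i φ) := (partialDList_smooth hφ [i]).continuous
    refine integral_mul_fderiv_eq_neg_fderiv_mul_of_integrable ?_ ?_ ?_ (fun x _ => du x)
      (fun x _ => hφ.differentiable (by simp) x)
    · exact (cu'.mul hφ.continuous).integrable_of_hasCompactSupport hφc.mul_left
    · exact (cu.mul cφ').integrable_of_hasCompactSupport (partialDList_compact huc l).mul_right
    · exact (cu.mul hφ.continuous).integrable_of_hasCompactSupport hφc.mul_left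
  · exact (partialDList_cont hu l hl).memLp_of_hasCompactSupport (partialDList_compact huc l)

theorem int_mul {n : ℕ} {f g : EV n → ℝ} {p : ℝ≥0∞} (hp1 : 1 ≤ p) (hf : MemLp f p volume)
    (hg : Continuous g) (hgc : HasCompactSupport g) : Integrable (fun x => f x * g x) volume :=
  (hf.locallyIntegrable hp1).integrable_smul_right_of_hasCompactSupport hg hgc

theorem sob_lin {n : ℕ} {u v : EV n → ℝ} {p : ℝ≥0∞} (hp1 : 1 ≤ p)
    {D E : List (Fin n) → EV n → ℝ}
    (hD : IsSobDerivs Set.univ 2 p u D) (hE : IsSobDerivs Set.univ 2 p v E) (a b : ℝ) :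
    IsSobDerivs Set.univ 2 p (fun x => a * u x + b * v x)
      (fun l x => a * D l x + b * E l x) := by
  refine ⟨by simp only [hD.1, hE.1], fun l hl i φ hφ hφc hs => ?_, fun l hl => ?_⟩
  · have h1 := hD.2.1 l hl i φ hφ hφc hs
    have h2 := hE.2.1 l hl i φ hφ hφc hs
    rw [Measure.restrict_univ] at *
    have cφ' : Continuous (partialD i φ) := (partialDList_smooth hφ [i]).continuous
    have hc' : HasCompactSupport (partialD i φ) := partialDList_compact hφc [i]
    have hl' : (i :: l).length ≤ 2 := by simpa using hl
    have i1 := (int_mul hp1 (sob_memLp hD l hl.le) cφ' hc').const_mul a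
    have i2 := (int_mul hp1 (sob_memLp hE l hl.le) cφ' hc').const_mul b
    have i3 := (int_mul hp1 (sob_memLp hD _ hl') hφ.continuous hφc).const_mul a
    have i4 := (int_mul hp1 (sob_memLp hE _ hl') hφ.continuous hφc).const_mul b
    simp only [add_mul, mul_assoc]
    rw [integral_add i1 i2, integral_add i3 i4]
    simp only [integral_const_mul]
    rw [h1, h2]
    ring
  · exact ((hD.2.2 l hl).const_mul a).add ((hE.2.2 l hl).const_mul b)

theorem sob_unique {n : ℕ} {u : EV n → ℝ} {p : ℝ≥0∞} (hp1 : 1 ≤ p)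
    {D E : List (Fin n) → EV n → ℝ}
    (hD : IsSobDerivs Set.univ 2 p u D) (hE : IsSobDerivs Set.univ 2 p u E)
    (l : List (Fin n)) (hl : l.length ≤ 2) : D l =ᵐ[volume] E l := by
  induction l with
  | nil => rw [hD.1, hE.1]
  | cons i l ih =>
    have hl1 : l.length < 2 := by simpa using hl
    refine ae_eq_of_integral_contDiff_smul_eq ((sob_memLp hD _ hl).locallyIntegrable hp1)
      ((sob_memLp hE _ hl).locallyIntegrable hp1) fun φ hφ hφc => ?_
    have h1 := hD.2.1 l hl1 i φ hφ hφc (Set.subset_univ _)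
    have h2 := hE.2.1 l hl1 i φ hφ hφc (Set.subset_univ _)
    rw [Measure.restrict_univ] at *
    have h3 : ∫ x, D l x * partialD i φ x = ∫ x, E l x * partialD i φ x := by
      refine integral_congr_ae ?_
      filter_upwards [ih hl1.le] with x hx
      rw [hx]
    simp only [smul_eq_mul, mul_comm (φ _)]
    linarith

theorem WNormD_smul {n : ℕ} (p : ℝ≥0∞) (A : List (Fin n) → EV n → ℝ) (a : ℝ) :
    WNormD 2 p volume (fun l x => a * A l x) = ‖a‖ₑ * WNormD 2 p volume A := by
  simp only [WNormD_eq]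
  rw [Finset.mul_sum]
  exact Finset.sum_congr rfl fun l _ => eLpNorm_const_smul a (A l) p volume

theorem WNormD_ne_top {n : ℕ} (p : ℝ≥0∞) {A : List (Fin n) → EV n → ℝ}
    (h : ∀ l, l.length ≤ 2 → MemLp (A l) p volume) : WNormD 2 p volume A ≠ ⊤ := by
  rw [WNormD_eq]
  exact ENNReal.sum_ne_top.2 fun l hl => (h l (by simpa using hl)).2.ne

theorem nlOp_memLp {n : ℕ} {ρ : EV n → ℝ} (hρ : A1 ρ) {ε : ℝ} (hε : 0 < ε) {u : EV n → ℝ}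
    (hu : ContDiff ℝ 2 u) (huc : HasCompactSupport u) {p : ℝ≥0∞} (hp1 : 1 ≤ p) (hp : p ≠ ⊤) :
    MemLp (nlOp ρ ε u) p volume := by
  refine ⟨(nlOp_meas hρ hu).aestronglyMeasurable, (nlOp_eLpNorm_le hρ hε hu p hp1 hp).trans_lt ?_⟩
  exact ENNReal.mul_lt_top ENNReal.ofReal_lt_top
    (WNormD_ne_top p fun l hl => sob_memLp (sob_classical p hu huc) l hl).lt_top

theorem nlOp_compare {n : ℕ} {ρ : EV n → ℝ} (hρ : A1 ρ) {ε : ℝ} (hε : 0 < ε) {u v : EV n → ℝ}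
    (hu : ContDiff ℝ 2 u) (huc : HasCompactSupport u) (hv : ContDiff ℝ 2 v)
    (hvc : HasCompactSupport v) {p : ℝ≥0∞} (hp1 : 1 ≤ p) (hp : p ≠ ⊤) :
    eLpNorm (nlOp ρ ε u - nlOp ρ ε v) p volume ≤ ENNReal.ofReal (∫ x, ρ x) *
      WNormD 2 p volume (fun l => partialDList l u - partialDList l v) := by
  have hw : ContDiff ℝ 2 (fun x => 1 * u x + (-1) * v x) :=
    (contDiff_const.mul hu).add (contDiff_const.mul hv)
  have h := nlOp_eLpNorm_le hρ hε hw p hp1 hp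
  rw [nlOp_lin hρ hε hu huc hv hvc 1 (-1)] at h
  have e1 : (fun x => 1 * nlOp ρ ε u x + (-1) * nlOp ρ ε v x) = nlOp ρ ε u - nlOp ρ ε v := by
    ext x; simp; ring
  rw [e1] at h
  refine h.trans_eq ?_
  congr 1
  refine WNormD_congr p fun l hl => ?_
  rw [partialDList_lin hu hv 1 (-1) l hl]
  congr 1; ext x; simp; ring

theorem eLpNorm_tri {n : ℕ} {p : ℝ≥0∞} (hp1 : 1 ≤ p) {f g h : EV n → ℝ}
    (hf : AEStronglyMeasurable f volume) (hg : AEStronglyMeasurable g volume)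
    (hh : AEStronglyMeasurable h volume) : eLpNorm (f - h) p volume ≤
      eLpNorm (f - g) p volume + eLpNorm (g - h) p volume := by
  have := eLpNorm_add_le (hf.sub hg) (hg.sub hh) hp1
  rwa [sub_add_sub_cancel] at this

theorem WNormD_tri {n : ℕ} {p : ℝ≥0∞} (hp1 : 1 ≤ p) {A B C : List (Fin n) → EV n → ℝ}
    (hA : ∀ l, l.length ≤ 2 → AEStronglyMeasurable (A l) volume)
    (hB : ∀ l, l.length ≤ 2 → AEStronglyMeasurable (B l) volume)
    (hC : ∀ l, l.length ≤ 2 → AEStronglyMeasurable (C l) volume) :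
    WNormD 2 p volume (fun l => A l - C l) ≤
      WNormD 2 p volume (fun l => A l - B l) + WNormD 2 p volume (fun l => B l - C l) := by
  have := WNormD_add_le p hp1 (A := fun l => A l - B l) (B := fun l => B l - C l)
    (fun l hl => (hA l hl).sub (hB l hl)) (fun l hl => (hB l hl).sub (hC l hl))
  simpa only [sub_add_sub_cancel] using this

theorem WNormD_comm {n : ℕ} {p : ℝ≥0∞} (A B : List (Fin n) → EV n → ℝ) :
    WNormD 2 p volume (fun l => A l - B l) = WNormD 2 p volume (fun l => B l - A l) :=
  WNormD_congr p fun _ _ => eLpNorm_sub_comm _ _ _ _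

theorem half_tendsto : Tendsto (fun k : ℕ => (2⁻¹ : ℝ≥0∞) ^ k) atTop (𝓝 0) :=
  ENNReal.tendsto_pow_atTop_nhds_zero_of_lt_one (by simp)

theorem half_ne (k : ℕ) : (2⁻¹ : ℝ≥0∞) ^ k ≠ 0 := by simp

theorem zero_of_small {c e : ℝ≥0∞} (hc : c ≠ ⊤) (h : ∀ δ : ℝ≥0∞, δ ≠ 0 → e ≤ c * δ) : e = 0 := by
  have h1 : Tendsto (fun k : ℕ => c * (2⁻¹ : ℝ≥0∞) ^ k) atTop (𝓝 (c * 0)) :=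
    ENNReal.Tendsto.const_mul half_tendsto (Or.inr hc)
  rw [mul_zero] at h1
  exact le_antisymm (ge_of_tendsto' h1 fun k => h _ (half_ne k)) (zero_le)

theorem exists_limit {n : ℕ} {ρ : EV n → ℝ} (hρ : A1 ρ) {ε : ℝ} (hε : 0 < ε) {p : ℝ≥0∞}
    (hp1 : 1 ≤ p) (hp : p ≠ ⊤) {u : EV n → ℝ} (hu : MemW Set.univ 2 p u) :
    ∃ w : EV n → ℝ, MemLp w p volume ∧ ∀ D, IsSobDerivs Set.univ 2 p u D →
      ∀ φ, ContDiff ℝ 2 φ → HasCompactSupport φ → eLpNorm (w - nlOp ρ ε φ) p volume ≤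
        ENNReal.ofReal (∫ x, ρ x) * WNormD 2 p volume (fun l => D l - partialDList l φ) := by
  obtain ⟨D, hD⟩ := hu
  set K := ENNReal.ofReal (∫ x, ρ x) with hK
  have hKt : K ≠ ⊤ := ENNReal.ofReal_ne_top
  have hDm : ∀ l : List (Fin n), l.length ≤ 2 → AEStronglyMeasurable (D l) volume :=
    fun l hl => (sob_memLp hD l hl).1
  choose φ hφ hφc hφD using fun k : ℕ => density hp1 hp hD (half_ne k)
  have hcmp : ∀ k (ψ : EV n → ℝ), ContDiff ℝ 2 ψ → HasCompactSupport ψ →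
      eLpNorm (nlOp ρ ε (φ k) - nlOp ρ ε ψ) p volume ≤
        K * ((2⁻¹ : ℝ≥0∞) ^ k + WNormD 2 p volume (fun l => D l - partialDList l ψ)) := by
    intro k ψ hψ hψc
    refine (nlOp_compare hρ hε (hφ k) (hφc k) hψ hψc hp1 hp).trans ?_
    gcongr
    refine (WNormD_tri hp1 (B := D) (fun l hl => partialDList_aesm (hφ k) l hl) hDm
      (fun l hl => partialDList_aesm hψ l hl)).trans ?_
    gcongr
    rw [WNormD_comm]
    exact hφD k
  have hm : ∀ k, MemLp (nlOp ρ ε (φ k)) p volume := fun k =>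
    nlOp_memLp hρ hε (hφ k) (hφc k) hp1 hp
  obtain ⟨w, hw, hlim⟩ := Lp.cauchy_complete_eLpNorm hp1 hm
    (B := fun k => (K * 2 + 1) * (2⁻¹ : ℝ≥0∞) ^ k) (by
      rw [ENNReal.tsum_mul_left, ENNReal.tsum_geometric]
      refine ENNReal.mul_ne_top (by finiteness) ?_
      rw [ENNReal.one_sub_inv_two]
      simp) (fun N i j hi hj => by
      have mono : ∀ {i : ℕ}, N ≤ i → (2⁻¹ : ℝ≥0∞) ^ i ≤ 2⁻¹ ^ N := fun h =>
        pow_le_pow_of_le_one zero_le (by simp) h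
      have hN : (2⁻¹ : ℝ≥0∞) ^ N ≠ ⊤ := by finiteness
      calc _ ≤ K * ((2⁻¹ : ℝ≥0∞) ^ i + WNormD 2 p volume (fun l => D l - partialDList l (φ j))) :=
            hcmp i (φ j) (hφ j) (hφc j)
        _ ≤ K * ((2⁻¹ : ℝ≥0∞) ^ N + (2⁻¹ : ℝ≥0∞) ^ N) := by
            exact mul_le_mul_right (add_le_add (mono hi) ((hφD j).trans (mono hj))) K
        _ = (K * 2) * (2⁻¹ : ℝ≥0∞) ^ N := by ring
        _ < (K * 2 + 1) * (2⁻¹ : ℝ≥0∞) ^ N := by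
            rw [add_mul, one_mul]
            exact ENNReal.lt_add_right (by finiteness) (half_ne N))
  refine ⟨w, hw, fun D' hD' ψ hψ hψc => ?_⟩
  have hW : WNormD 2 p volume (fun l => D' l - partialDList l ψ) =
      WNormD 2 p volume (fun l => D l - partialDList l ψ) :=
    WNormD_congr p fun l hl => eLpNorm_congr_ae
      ((sob_unique hp1 hD' hD l hl).sub (ae_eq_refl _))
  rw [hW]
  have hb : ∀ k, eLpNorm (w - nlOp ρ ε ψ) p volume ≤ eLpNorm (nlOp ρ ε (φ k) - w) p volume +
      K * ((2⁻¹ : ℝ≥0∞) ^ k + WNormD 2 p volume (fun l => D l - partialDList l ψ)) := fun k => by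
    refine (eLpNorm_tri hp1 hw.1 (hm k).1 (nlOp_memLp hρ hε hψ hψc hp1 hp).1).trans ?_
    rw [eLpNorm_sub_comm w]
    gcongr
    exact hcmp k ψ hψ hψc
  have ht := hlim.add (ENNReal.Tendsto.const_mul (a := K)
    (half_tendsto.add (tendsto_const_nhds
      (x := WNormD 2 p volume (fun l => D l - partialDList l ψ)))) (Or.inr hKt))
  rw [zero_add, zero_add] at ht
  exact ge_of_tendsto' ht hb

theorem ae_of_eLpNorm {n : ℕ} {p : ℝ≥0∞} (hp1 : 1 ≤ p) {f g : EV n → ℝ}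
    (hf : AEStronglyMeasurable f volume) (hg : AEStronglyMeasurable g volume)
    (h : eLpNorm (f - g) p volume = 0) : f =ᵐ[volume] g := by
  rw [eLpNorm_eq_zero_iff (hf.sub hg) (zero_lt_one.trans_le hp1).ne'] at h
  filter_upwards [h] with x hx
  simpa [sub_eq_zero] using hx

theorem lin_close {n : ℕ} {p : ℝ≥0∞} (hp1 : 1 ≤ p) {f g f' g' : EV n → ℝ}
    (hf : AEStronglyMeasurable f volume) (hg : AEStronglyMeasurable g volume)
    (hf' : AEStronglyMeasurable f' volume) (hg' : AEStronglyMeasurable g' volume) (a b : ℝ) :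
    eLpNorm ((fun x => a * f x + b * g x) - fun x => a * f' x + b * g' x) p volume ≤
      ‖a‖ₑ * eLpNorm (f - f') p volume + ‖b‖ₑ * eLpNorm (g - g') p volume := by
  have e : ((fun x => a * f x + b * g x) - fun x => a * f' x + b * g' x) =
      a • (f - f') + b • (g - g') := by
    ext x; simp; ring
  rw [e]
  refine (eLpNorm_add_le ((hf.sub hf').const_smul a) ((hg.sub hg').const_smul b) hp1).trans ?_
  rw [eLpNorm_const_smul, eLpNorm_const_smul]

theorem WNormD_lin_close {n : ℕ} {p : ℝ≥0∞} (hp1 : 1 ≤ p) {A B A' B' : List (Fin n) → EV n → ℝ}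
    (hA : ∀ l, l.length ≤ 2 → AEStronglyMeasurable (A l) volume)
    (hB : ∀ l, l.length ≤ 2 → AEStronglyMeasurable (B l) volume)
    (hA' : ∀ l, l.length ≤ 2 → AEStronglyMeasurable (A' l) volume)
    (hB' : ∀ l, l.length ≤ 2 → AEStronglyMeasurable (B' l) volume) (a b : ℝ) :
    WNormD 2 p volume (fun l => (fun x => a * A l x + b * B l x) -
      fun x => a * A' l x + b * B' l x) ≤
      ‖a‖ₑ * WNormD 2 p volume (fun l => A l - A' l) +
        ‖b‖ₑ * WNormD 2 p volume (fun l => B l - B' l) := by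
  simp only [WNormD_eq]
  rw [Finset.mul_sum, Finset.mul_sum, ← Finset.sum_add_distrib]
  refine Finset.sum_le_sum fun l hl => ?_
  have hl : l.length ≤ 2 := by simpa using hl
  exact lin_close hp1 (hA l hl) (hB l hl) (hA' l hl) (hB' l hl) a b

open Classical in
/-- the extension -/
def theExt {n : ℕ} {ρ : EV n → ℝ} (hρ : A1 ρ) {ε : ℝ} (hε : 0 < ε) {p : ℝ≥0∞}
    (hp1 : 1 ≤ p) (hp : p ≠ ⊤) (u : EV n → ℝ) : EV n → ℝ :=
  if hu : MemW Set.univ 2 p u then (exists_limit hρ hε hp1 hp hu).choose else 0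

theorem theExt_memLp {n : ℕ} {ρ : EV n → ℝ} (hρ : A1 ρ) {ε : ℝ} (hε : 0 < ε) {p : ℝ≥0∞}
    (hp1 : 1 ≤ p) (hp : p ≠ ⊤) {u : EV n → ℝ} (hu : MemW Set.univ 2 p u) :
    MemLp (theExt hρ hε hp1 hp u) p volume := by
  rw [theExt, dif_pos hu]
  exact (exists_limit hρ hε hp1 hp hu).choose_spec.1

theorem theExt_le {n : ℕ} {ρ : EV n → ℝ} (hρ : A1 ρ) {ε : ℝ} (hε : 0 < ε) {p : ℝ≥0∞}
    (hp1 : 1 ≤ p) (hp : p ≠ ⊤) {u : EV n → ℝ} {D : List (Fin n) → EV n → ℝ}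
    (hD : IsSobDerivs Set.univ 2 p u D)
    {φ : EV n → ℝ} (hφ : ContDiff ℝ 2 φ) (hφc : HasCompactSupport φ) :
    eLpNorm (theExt hρ hε hp1 hp u - nlOp ρ ε φ) p volume ≤
        ENNReal.ofReal (∫ x, ρ x) * WNormD 2 p volume (fun l => D l - partialDList l φ) := by
  have hu : MemW Set.univ 2 p u := ⟨D, hD⟩
  rw [theExt, dif_pos hu]
  exact (exists_limit hρ hε hp1 hp hu).choose_spec.2 D hD φ hφ hφc

theorem partialDList_zero {n : ℕ} (l : List (Fin n)) :
    partialDList l (fun _ => (0 : ℝ)) = fun _ => 0 := by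
  induction l with
  | nil => rfl
  | cons i l ih =>
    rw [partialDList, ih]
    ext x
    simp [partialD]

theorem theExt_isExt {n : ℕ} {ρ : EV n → ℝ} (hρ : A1 ρ) {ε : ℝ} (hε : 0 < ε) {p : ℝ≥0∞}
    (hp1 : 1 ≤ p) (hp : p ≠ ⊤) : IsNLExt ρ p ε ((∫ x, ρ x) + 1) (theExt hρ hε hp1 hp) := by
  refine ⟨fun u hu huc => ?_, fun u v hu hv a b => ?_, fun u hu => theExt_memLp hρ hε hp1 hp hu,
    fun u D hD => ?_⟩
  · have hD := sob_classical p hu huc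
    refine ae_of_eLpNorm hp1 (theExt_memLp hρ hε hp1 hp ⟨_, hD⟩).1
      (nlOp_memLp hρ hε hu huc hp1 hp).1 ?_
    have h := theExt_le hρ hε hp1 hp hD hu huc
    simpa [WNormD_eq] using h
  · obtain ⟨D, hD⟩ := hu
    obtain ⟨E, hE⟩ := hv
    have hDE := sob_lin hp1 hD hE a b
    have m1 := (theExt_memLp hρ hε hp1 hp ⟨_, hD⟩).1
    have m2 := (theExt_memLp hρ hε hp1 hp ⟨_, hE⟩).1
    have m3 := (theExt_memLp hρ hε hp1 hp ⟨_, hDE⟩).1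
    have m4 : AEStronglyMeasurable (fun x => a * theExt hρ hε hp1 hp u x +
      b * theExt hρ hε hp1 hp v x) volume := (m1.const_mul a).add (m2.const_mul b)
    refine ae_of_eLpNorm hp1 m3 m4 ?_
    set K := ENNReal.ofReal (∫ x, ρ x) with hK
    have hKt : K ≠ ⊤ := ENNReal.ofReal_ne_top
    refine zero_of_small (c := K * (‖a‖ₑ + ‖b‖ₑ) + K * (‖a‖ₑ + ‖b‖ₑ)) (by finiteness)
      fun δ hδ => ?_
    obtain ⟨φ, hφ, hφc, hφD⟩ := density hp1 hp hD hδ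
    obtain ⟨ψ, hψ, hψc, hψE⟩ := density hp1 hp hE hδ
    have hχ : ContDiff ℝ 2 (fun x => a * φ x + b * ψ x) :=
      (contDiff_const.mul hφ).add (contDiff_const.mul hψ)
    have hχc : HasCompactSupport (fun x => a * φ x + b * ψ x) := hφc.mul_left.add hψc.mul_left
    have n1 := (nlOp_memLp hρ hε hφ hφc hp1 hp).1
    have n2 := (nlOp_memLp hρ hε hψ hψc hp1 hp).1
    refine (eLpNorm_tri hp1 m3 (nlOp_memLp hρ hε hχ hχc hp1 hp).1 m4).trans ?_
    rw [add_mul]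
    refine add_le_add ?_ ?_
    · refine (theExt_le hρ hε hp1 hp hDE hχ hχc).trans ?_
      rw [mul_assoc, add_mul]
      gcongr
      have h := WNormD_lin_close hp1 (fun l hl => (sob_memLp hD l hl).1)
        (fun l hl => (sob_memLp hE l hl).1) (fun l hl => partialDList_aesm hφ l hl)
        (fun l hl => partialDList_aesm hψ l hl) a b
      refine le_trans (le_of_eq ?_) (h.trans (by gcongr))
      refine WNormD_congr p fun l hl => ?_
      rw [partialDList_lin hφ hψ a b l hl]
    · rw [nlOp_lin hρ hε hφ hφc hψ hψc a b]
      refine (lin_close hp1 n1 n2 m1 m2 a b).trans ?_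
      rw [eLpNorm_sub_comm, eLpNorm_sub_comm (nlOp ρ ε ψ)]
      have h1 := (theExt_le hρ hε hp1 hp hD hφ hφc).trans (mul_le_mul_right hφD K)
      have h2 := (theExt_le hρ hε hp1 hp hE hψ hψc).trans (mul_le_mul_right hψE K)
      calc _ ≤ ‖a‖ₑ * (K * δ) + ‖b‖ₑ * (K * δ) := by gcongr
        _ = _ := by ring
  · have h := theExt_le hρ hε hp1 hp hD (φ := fun _ => (0 : ℝ)) contDiff_const
      HasCompactSupport.zero
    have e : nlOp ρ ε (fun _ : EV n => (0 : ℝ)) = 0 := by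
      ext x
      simp [nlOp]
    simp only [partialDList_zero] at h
    rw [e, sub_zero] at h
    have e2 : (fun l => D l - fun _ => (0 : ℝ)) = D := by
      ext l x; simp
    rw [e2] at h
    refine h.trans ?_
    gcongr
    linarith

theorem ext_unique {n : ℕ} {ρ : EV n → ℝ} {ε : ℝ} {p : ℝ≥0∞}
    (hp1 : 1 ≤ p) (hp : p ≠ ⊤) {C₁ C₂ : ℝ} {L₁ L₂ : (EV n → ℝ) → EV n → ℝ}
    (h₁ : IsNLExt ρ p ε C₁ L₁) (h₂ : IsNLExt ρ p ε C₂ L₂) {u : EV n → ℝ}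
    (hu : MemW Set.univ 2 p u) : L₁ u =ᵐ[volume] L₂ u := by
  have m1 := (h₁.2.2.1 u hu).1
  have m2 := (h₂.2.2.1 u hu).1
  obtain ⟨D, hD⟩ := hu
  refine ae_of_eLpNorm hp1 m1 m2 ?_
  refine zero_of_small (c := ENNReal.ofReal C₁ + ENNReal.ofReal C₂) (by finiteness) fun δ hδ => ?_
  obtain ⟨φ, hφ, hφc, hφD⟩ := density hp1 hp hD hδ
  have hφS := sob_classical p hφ hφc
  have key : ∀ {C : ℝ} {L : (EV n → ℝ) → EV n → ℝ}, IsNLExt ρ p ε C L →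
      eLpNorm (L u - nlOp ρ ε φ) p volume ≤ ENNReal.ofReal C * δ := by
    intro C L h
    have hb := h.2.2.2 _ _ (sob_lin hp1 hD hφS 1 (-1))
    have e : L (fun x => 1 * u x + (-1) * φ x) =ᵐ[volume] L u - nlOp ρ ε φ := by
      filter_upwards [h.2.1 u φ ⟨_, hD⟩ ⟨_, hφS⟩ 1 (-1), h.1 φ hφ hφc] with x h1 h2
      rw [h1, h2, Pi.sub_apply]; ring
    rw [eLpNorm_congr_ae e] at hb
    refine hb.trans ?_
    gcongr
    refine le_trans (le_of_eq ?_) hφD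
    congr 1
    ext l x
    simp; ring
  have mφ : AEStronglyMeasurable (nlOp ρ ε φ) volume :=
    (h₁.2.2.1 φ ⟨_, hφS⟩).1.congr (h₁.1 φ hφ hφc)
  refine (eLpNorm_tri hp1 m1 mφ m2).trans ?_
  rw [eLpNorm_sub_comm (nlOp ρ ε φ), add_mul]
  exact add_le_add (key h₁) (key h₂)

/-- bounded extension to `W^{2,p}(ℝⁿ)`: the operator `L_ε` on `C_c²(ℝⁿ)`
extends uniquely to a bounded linear operator `L_ε : W^{2,p}(ℝⁿ) → L^p(ℝⁿ)` with
`‖L_ε u‖_{L^p} ≤ C_* ‖u‖_{W^{2,p}}` for all `u ∈ W^{2,p}(ℝⁿ)`, where `C_* > 0` depends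
only on `ρ` and `p` (in particular it is independent of `ε`). -/
theorem nlOp_extension_W2p (n : ℕ) (hn : 1 ≤ n) (ρ : EV n → ℝ) (hρ : A1 ρ)
    (p : ℝ≥0∞) (hp1 : 1 ≤ p) (hp : p ≠ ⊤) :
    ∃ C : ℝ, 0 < C ∧ ∀ ε : ℝ, 0 < ε →
      (∃ L : (EV n → ℝ) → EV n → ℝ, IsNLExt ρ p ε C L) ∧
      (∀ (C₁ C₂ : ℝ) (L₁ L₂ : (EV n → ℝ) → EV n → ℝ),
        IsNLExt ρ p ε C₁ L₁ → IsNLExt ρ p ε C₂ L₂ →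
        ∀ u : EV n → ℝ, MemW Set.univ 2 p u → L₁ u =ᵐ[volume] L₂ u) := by
  refine ⟨(∫ x, ρ x) + 1, ?_, fun ε hε => ⟨⟨_, theExt_isExt hρ hε hp1 hp⟩, ?_⟩⟩
  · have : 0 ≤ ∫ x, ρ x := integral_nonneg hρ.2.1
    linarith
  · intro C₁ C₂ L₁ L₂ h₁ h₂ u hu
    exact ext_unique hp1 hp h₁ h₂ hu
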